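/- arXiv:2211.06457 — 2 statements merged into one kernel-verified Lean document; each statement's English description precedes it below -/
import Mathlib

section
/- Let Θ be any set, L : Θ → ℝ and ψ : Θ → ℝ any functions, and λ > 0. If θ̂ maximizes L over Θ and θ̂(λ) maximizes L(θ) + λψ(θ) over Θ, then ψ(θ̂(λ)) ≥ ψ(θ̂); consequently the finite-difference implicit-delta-method estimate V̂^{FDIDM} = (ψ(θ̂(λ)) − ψ(θ̂))/λ is nonnegative. -/
/-- **Nonnegativity of the finite-difference implicit-delta-method estimate.**
For any set `Θ`, functions `L, ψ : Θ → ℝ` and `λ > 0`, if `θ̂` maximizes `L` over `Θ` and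
`θ̂(λ)` maximizes `L + λψ` over `Θ`, then `ψ(θ̂(λ)) ≥ ψ(θ̂)`; consequently
`V̂^FDIDM = (ψ(θ̂(λ)) − ψ(θ̂))/λ ≥ 0`. -/
theorem fdidm_nonneg {Θ : Type*} (L ψ : Θ → ℝ) (lam : ℝ) (hlam : 0 < lam)
    (θhat θhatlam : Θ)
    (hmax : ∀ θ : Θ, L θ ≤ L θhat)
    (hmaxreg : ∀ θ : Θ, L θ + lam * ψ θ ≤ L θhatlam + lam * ψ θhatlam) :
    ψ θhat ≤ ψ θhatlam ∧ 0 ≤ (ψ θhatlam - ψ θhat) / lam := by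
  have h1 := hmax θhatlam
  have h2 := hmaxreg θhat
  have h : ψ θhat ≤ ψ θhatlam := le_of_mul_le_mul_left (by linarith) hlam
  exact ⟨h, div_nonneg (sub_nonneg.mpr h) hlam.le⟩
end

section
/- Let T_n and E_n be sequences of real-valued random variables that are independent for each n, and let s_n, t_n > 0 be deterministic with T_n/s_n ⇝ N(0,1) and E_n/t_n ⇝ N(0,1). Let ŝ_n², t̂_n² be nonnegative random variables with ŝ_n²/s_n² →_p 1 and t̂_n²/t_n² →_p 1, and suppose (ŝ_n², T_n) is independent of (t̂_n², E_n) for each n. Then (T_n + E_n)/√(ŝ_n² + t̂_n²) ⇝ N(0,1). -/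
open MeasureTheory ProbabilityTheory Filter Topology Set

noncomputable section

/-- Convergence in distribution of real-valued statistics: the pushforward laws integrate every
bounded continuous function to the limit value. -/
def ConvInDist {Ω : Type*} [MeasurableSpace Ω] (P : Measure Ω)
    (X : ℕ → Ω → ℝ) (ν : Measure ℝ) : Prop :=
  ∀ g : BoundedContinuousFunction ℝ ℝ,
    Tendsto (fun n => ∫ ω, g (X n ω) ∂P) atTop (𝓝 (∫ x, g x ∂ν))

lemma convInDist_iff_aux {Ω : Type*} [MeasurableSpace Ω] (P : Measure Ω) [IsProbabilityMeasure P]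
    (X : ℕ → Ω → ℝ) (hX : ∀ n, Measurable (X n)) (ν : Measure ℝ) [IsProbabilityMeasure ν] :
    ConvInDist P X ν ↔ TendstoInDistribution X atTop (id : ℝ → ℝ) (fun _ => P) ν := by
  have key : ∀ (g : BoundedContinuousFunction ℝ ℝ) (n : ℕ),
      ∫ x, g x ∂(P.map (X n)) = ∫ ω, g (X n ω) ∂P := fun g n =>
    integral_map (hX n).aemeasurable g.continuous.aestronglyMeasurable
  have key2 : ∀ (g : BoundedContinuousFunction ℝ ℝ),
      ∫ x, g x ∂(ν.map id) = ∫ x, g x ∂ν := fun g => by rw [Measure.map_id]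
  constructor
  · intro h
    refine ⟨fun n => (hX n).aemeasurable, aemeasurable_id, ?_⟩
    refine ProbabilityMeasure.tendsto_iff_forall_integral_tendsto.2 ?_
    intro g
    simp only [ProbabilityMeasure.coe_mk, key, key2]
    exact h g
  · intro h g
    have h1 := ProbabilityMeasure.tendsto_iff_forall_integral_tendsto.1 h.tendsto g
    simp only [ProbabilityMeasure.coe_mk, key, key2] at h1
    exact h1

lemma tendstoInMeasure_const_aux {Ω : Type*} [MeasurableSpace Ω] (P : Measure Ω)
    [IsProbabilityMeasure P] {c : ℕ → ℝ} {a : ℝ} (hc : Tendsto c atTop (𝓝 a)) :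
    TendstoInMeasure P (fun n (_ : Ω) => c n) atTop (fun _ => a) :=
  tendstoInMeasure_of_tendsto_ae (fun _ => aestronglyMeasurable_const)
    (Eventually.of_forall fun _ => hc)

lemma charFun_tendsto_aux {Ω : Type*} [MeasurableSpace Ω] (P : Measure Ω) [IsProbabilityMeasure P]
    (X : ℕ → Ω → ℝ) (hX : ∀ n, Measurable (X n))
    (h : ConvInDist P X (gaussianReal 0 1)) {c : ℕ → ℝ} {a : ℝ} (hc : Tendsto c atTop (𝓝 a))
    (u : ℝ) :
    Tendsto (fun n => charFun (P.map (X n)) (c n * u)) atTop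
      (𝓝 (charFun (gaussianReal 0 1) (a * u))) := by
  have h1 := (convInDist_iff_aux P X hX _).1 h
  have h2 := h1.continuous_comp_prodMk_of_tendstoInMeasure_const
    (g := fun p : ℝ × ℝ => p.2 * p.1) (by fun_prop) (tendstoInMeasure_const_aux P hc)
    (fun _ => aemeasurable_const)
  have h3 := ProbabilityMeasure.tendsto_iff_tendsto_charFun.1 h2.tendsto u
  simp only [ProbabilityMeasure.coe_mk] at h3
  have e1 : ∀ n, charFun (P.map (fun ω => c n * X n ω)) u
      = charFun (P.map (X n)) (c n * u) := fun n =>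
    charFun_map_mul_comp (hX n).aemeasurable (c n) u
  simp only [e1, id, charFun_map_mul] at h3
  exact h3

lemma combine_known_scale_aux
    {Ω : Type*} [MeasurableSpace Ω] (P : Measure Ω) [IsProbabilityMeasure P]
    (X Y : ℕ → Ω → ℝ) (hX : ∀ n, Measurable (X n)) (hY : ∀ n, Measurable (Y n))
    (hXd : ConvInDist P X (gaussianReal 0 1)) (hYd : ConvInDist P Y (gaussianReal 0 1))
    (a b : ℕ → ℝ) (hab : ∀ n, a n ^ 2 + b n ^ 2 = 1)
    (hind : ∀ n, IndepFun (X n) (Y n) P) :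
    ConvInDist P (fun n ω => a n * X n ω + b n * Y n ω) (gaussianReal 0 1) := by
  have hm : ∀ n, Measurable (fun ω => a n * X n ω + b n * Y n ω) := fun n =>
    ((hX n).const_mul _).add ((hY n).const_mul _)
  rw [convInDist_iff_aux P _ hm]
  refine ⟨fun n => (hm n).aemeasurable, aemeasurable_id, ?_⟩
  refine ProbabilityMeasure.tendsto_iff_tendsto_charFun.2 ?_
  intro u
  simp only [ProbabilityMeasure.coe_mk, Measure.map_id]
  have e : ∀ n, charFun (P.map (fun ω => a n * X n ω + b n * Y n ω)) u
      = charFun (P.map (X n)) (a n * u) * charFun (P.map (Y n)) (b n * u) := by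
    intro n
    have hi : IndepFun (fun ω => a n * X n ω) (fun ω => b n * Y n ω) P :=
      (hind n).comp (φ := fun x => a n * x) (ψ := fun x => b n * x)
        (measurable_const_mul _) (measurable_const_mul _)
    rw [hi.charFun_map_fun_add_eq_mul ((hX n).const_mul _).aemeasurable
      ((hY n).const_mul _).aemeasurable, Pi.mul_apply,
      charFun_map_mul_comp (hX n).aemeasurable, charFun_map_mul_comp (hY n).aemeasurable]
  simp only [e]
  refine tendsto_of_subseq_tendsto fun ns hns => ?_
  have hmem : ∀ k, (a (ns k), b (ns k)) ∈ Icc (-1 : ℝ) 1 ×ˢ Icc (-1 : ℝ) 1 := by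
    intro k
    have := hab (ns k)
    simp only [mem_prod, mem_Icc]
    refine ⟨⟨?_, ?_⟩, ?_, ?_⟩ <;> nlinarith [sq_nonneg (a (ns k)), sq_nonneg (b (ns k))]
  obtain ⟨p, -, ms, hms, hlim⟩ := (isCompact_Icc.prod isCompact_Icc).tendsto_subseq hmem
  refine ⟨ms, ?_⟩
  have ha : Tendsto (fun k => a (ns (ms k))) atTop (𝓝 p.1) :=
    (continuous_fst.tendsto p).comp hlim
  have hb : Tendsto (fun k => b (ns (ms k))) atTop (𝓝 p.2) :=
    (continuous_snd.tendsto p).comp hlim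
  have hsub : Tendsto (fun k => ns (ms k)) atTop atTop := hns.comp hms.tendsto_atTop
  have hp : p.1 ^ 2 + p.2 ^ 2 = 1 := by
    have h1 := (ha.pow 2).add (hb.pow 2)
    simp only [hab] at h1
    exact (tendsto_nhds_unique h1 tendsto_const_nhds)
  have hA := charFun_tendsto_aux P (fun k => X (ns (ms k))) (fun k => hX _)
    (fun g => (hXd g).comp hsub) ha u
  have hB := charFun_tendsto_aux P (fun k => Y (ns (ms k))) (fun k => hY _)
    (fun g => (hYd g).comp hsub) hb u
  convert hA.mul hB using 2
  simp only [charFun_gaussianReal]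
  rw [← Complex.exp_add]
  congr 1
  have hp' : (p.1 : ℂ) ^ 2 + (p.2 : ℂ) ^ 2 = 1 := by exact_mod_cast hp
  push_cast
  linear_combination (u : ℂ) ^ 2 / 2 * hp'

/-- **Combining independent asymptotically normal errors with estimated scales.**
If `T_n/s_n ⇝ N(0,1)`, `E_n/t_n ⇝ N(0,1)` with `T_n` and `E_n` independent for each `n`,
`ŝ_n²/s_n² →_p 1`, `t̂_n²/t_n² →_p 1` with `(ŝ_n², T_n)` independent of `(t̂_n², E_n)`, then
`(T_n + E_n)/√(ŝ_n² + t̂_n²) ⇝ N(0,1)`. -/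
theorem combine_independent_normal_limits
    {Ω : Type*} [MeasurableSpace Ω] (P : Measure Ω) [IsProbabilityMeasure P]
    (T E : ℕ → Ω → ℝ) (hTmeas : ∀ n, Measurable (T n)) (hEmeas : ∀ n, Measurable (E n))
    (s t : ℕ → ℝ) (hs : ∀ n, 0 < s n) (ht : ∀ n, 0 < t n)
    (hTdist : ConvInDist P (fun n ω => T n ω / s n) (gaussianReal 0 1))
    (hEdist : ConvInDist P (fun n ω => E n ω / t n) (gaussianReal 0 1))
    (shat2 that2 : ℕ → Ω → ℝ)
    (hshatmeas : ∀ n, Measurable (shat2 n)) (hthatmeas : ∀ n, Measurable (that2 n))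
    (hshatnonneg : ∀ n ω, 0 ≤ shat2 n ω) (hthatnonneg : ∀ n ω, 0 ≤ that2 n ω)
    (hshat : TendstoInMeasure P (fun n ω => shat2 n ω / (s n) ^ 2) atTop fun _ => (1 : ℝ))
    (hthat : TendstoInMeasure P (fun n ω => that2 n ω / (t n) ^ 2) atTop fun _ => (1 : ℝ))
    (hTEindep : ∀ n, IndepFun (T n) (E n) P)
    (hindep : ∀ n, IndepFun (fun ω => (shat2 n ω, T n ω)) (fun ω => (that2 n ω, E n ω)) P) :
    ConvInDist P (fun n ω => (T n ω + E n ω) / Real.sqrt (shat2 n ω + that2 n ω))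
      (gaussianReal 0 1) := by
  set v : ℕ → ℝ := fun n => s n ^ 2 + t n ^ 2 with hv
  have hs2 : ∀ n, 0 < s n ^ 2 := fun n => pow_pos (hs n) 2
  have ht2 : ∀ n, 0 < t n ^ 2 := fun n => pow_pos (ht n) 2
  have hvpos : ∀ n, 0 < v n := fun n => add_pos (hs2 n) (ht2 n)
  set R : ℕ → Ω → ℝ := fun n ω => (shat2 n ω + that2 n ω) / v n with hR
  have hRmeas : ∀ n, Measurable (R n) := fun n => ((hshatmeas n).add (hthatmeas n)).div_const _
  -- the pooled variance ratio converges to one in probability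
  have hRlim : TendstoInMeasure P R atTop (fun _ => (1 : ℝ)) := by
    rw [tendstoInMeasure_iff_dist] at hshat hthat ⊢
    intro ε hε
    have hsum := (hshat ε hε).add (hthat ε hε)
    rw [add_zero] at hsum
    refine tendsto_of_tendsto_of_tendsto_of_le_of_le tendsto_const_nhds hsum
      (fun _ => zero_le) fun n => ?_
    refine (measure_mono ?_).trans (measure_union_le _ _)
    intro ω hω
    simp only [mem_ofPred_eq, mem_union, Real.dist_eq] at hω ⊢
    by_contra! hcon
    obtain ⟨h1, h2⟩ := hcon
    have e1 : shat2 n ω / s n ^ 2 - 1 = (shat2 n ω - s n ^ 2) / s n ^ 2 := by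
      rw [sub_div, div_self (hs2 n).ne']
    have e2 : that2 n ω / t n ^ 2 - 1 = (that2 n ω - t n ^ 2) / t n ^ 2 := by
      rw [sub_div, div_self (ht2 n).ne']
    have e3 : R n ω - 1 = ((shat2 n ω - s n ^ 2) + (that2 n ω - t n ^ 2)) / v n := by
      rw [sub_eq_iff_eq_add, hR]
      simp only
      rw [div_eq_iff (hvpos n).ne', add_mul, div_mul_cancel₀ _ (hvpos n).ne', hv]
      ring
    rw [e1, abs_div, abs_of_pos (hs2 n), div_lt_iff₀ (hs2 n)] at h1
    rw [e2, abs_div, abs_of_pos (ht2 n), div_lt_iff₀ (ht2 n)] at h2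
    rw [e3, abs_div, abs_of_pos (hvpos n), le_div_iff₀ (hvpos n)] at hω
    have h3 := abs_add_le (shat2 n ω - s n ^ 2) (that2 n ω - t n ^ 2)
    have h4 : ε * v n = ε * s n ^ 2 + ε * t n ^ 2 := by rw [hv]; ring
    linarith
  -- the numerator with the known scale
  set W : ℕ → Ω → ℝ := fun n ω =>
    s n / √(v n) * (T n ω / s n) + t n / √(v n) * (E n ω / t n) with hW
  have hWdist : ConvInDist P W (gaussianReal 0 1) := by
    refine combine_known_scale_aux P (fun n ω => T n ω / s n) (fun n ω => E n ω / t n)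
      (fun n => (hTmeas n).div_const _) (fun n => (hEmeas n).div_const _) hTdist hEdist
      (fun n => s n / √(v n)) (fun n => t n / √(v n)) (fun n => ?_) (fun n => ?_)
    · rw [div_pow, div_pow, Real.sq_sqrt (hvpos n).le, ← add_div]
      exact div_self (hvpos n).ne'
    · exact (hTEindep n).comp (φ := fun x => x / s n) (ψ := fun x => x / t n)
        (measurable_id.div_const _) (measurable_id.div_const _)
  have hWmeas : ∀ n, Measurable (W n) := fun n =>
    (((hTmeas n).div_const _).const_mul _).add (((hEmeas n).div_const _).const_mul _)
  have hWeq : ∀ n ω, (T n ω + E n ω) / √(shat2 n ω + that2 n ω) = W n ω / √(R n ω) := by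
    intro n ω
    have h1 : W n ω = (T n ω + E n ω) / √(v n) := by
      have := (hs n).ne'
      have := (ht n).ne'
      have := (Real.sqrt_pos.2 (hvpos n)).ne'
      simp only [hW]
      field_simp
    rw [h1, hR]
    simp only
    rw [Real.sqrt_div (add_nonneg (hshatnonneg n ω) (hthatnonneg n ω)),
      div_div_div_cancel_right₀ (Real.sqrt_pos.2 (hvpos n)).ne']
  have hfmeas : ∀ n, Measurable (fun ω => W n ω / √(R n ω)) := fun n =>
    (hWmeas n).div (hRmeas n).sqrt
  simp only [hWeq]
  rw [convInDist_iff_aux P _ hfmeas]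
  -- Slutsky with a truncated denominator
  have hcont : Continuous (fun p : ℝ × ℝ => p.1 / √(max p.2 (1 / 2))) := by
    refine continuous_fst.div (by fun_prop) fun p => ?_
    exact (Real.sqrt_pos.2 (lt_max_of_lt_right (by norm_num))).ne'
  have hSl := ((convInDist_iff_aux P W hWmeas _).1 hWdist
    ).continuous_comp_prodMk_of_tendstoInMeasure_const hcont hRlim
      (fun n => (hRmeas n).aemeasurable)
  have hlim : (fun x : ℝ => id x / √(max (1 : ℝ) (1 / 2))) = id := by
    funext x
    rw [max_eq_left (by norm_num), Real.sqrt_one, div_one]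
  simp only [hlim] at hSl
  refine tendstoInDistribution_of_tendstoInMeasure_sub _ _ hSl ?_
    (fun n => (hfmeas n).aemeasurable)
  rw [tendstoInMeasure_iff_dist] at hRlim ⊢
  intro ε hε
  refine tendsto_of_tendsto_of_tendsto_of_le_of_le tendsto_const_nhds
    (hRlim (1 / 2) (by norm_num)) (fun _ => zero_le) fun n => measure_mono ?_
  intro ω hω
  simp only [mem_ofPred_eq, Real.dist_eq, Pi.sub_apply, Pi.zero_apply] at hω ⊢
  by_contra! hcon
  have h1 := (abs_lt.1 hcon).1
  rw [max_eq_left (by linarith), sub_self, sub_zero, abs_zero] at hω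
  linarith
end
end
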